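/- For all positive integers k and p, the number of domino tilings of the region T(k,2k+1,p) is even. -/

import Mathlib

/-- Two cells of `ℤ × ℤ` are adjacent if they differ by `(1,0)` or `(0,1)`. -/
def Adjacent (a b : ℤ × ℤ) : Prop :=
  (a.1 = b.1 ∧ (a.2 = b.2 + 1 ∨ b.2 = a.2 + 1)) ∨
  (a.2 = b.2 ∧ (a.1 = b.1 + 1 ∨ b.1 = a.1 + 1))

/-- `T` is a domino tiling of `R`: a partition of `R` into two-element sets of adjacent cells. -/
def IsDominoTiling (R : Set (ℤ × ℤ)) (T : Set (Set (ℤ × ℤ))) : Prop :=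
  (∀ d ∈ T, ∃ a b, Adjacent a b ∧ d = {a, b}) ∧
  T.PairwiseDisjoint id ∧
  ⋃₀ T = R

/-- The number of domino tilings of `R`. -/
noncomputable def numTilings (R : Set (ℤ × ℤ)) : ℕ :=
  Nat.card {T : Set (Set (ℤ × ℤ)) // IsDominoTiling R T}

/-- The region `T(i,j,p)`: rows `r = 0, …, i+p-2` from top to bottom of lengths
`j, j+2, …, j+2(p-2)` followed by `i` rows of length `j+2(p-1)`, centers aligned. -/
def Treg (i j p : ℕ) : Set (ℤ × ℤ) :=
  {q | 0 ≤ q.2 ∧ q.2 ≤ (i : ℤ) + p - 2 ∧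
    (p : ℤ) - 1 - min q.2 ((p : ℤ) - 1) ≤ q.1 ∧
    q.1 ≤ (p : ℤ) - 2 + j + min q.2 ((p : ℤ) - 1)}

theorem adjacent_symm' {a b : ℤ × ℤ} (h : Adjacent a b) : Adjacent b a := by
  unfold Adjacent at *; omega

theorem adjacent_ne' {a b : ℤ × ℤ} (h : Adjacent a b) : a ≠ b := by
  rintro rfl; unfold Adjacent at h; omega

open Classical in
theorem even_involutions {V : Type*} [Fintype V] (adj : V → V → Prop)
    (hs : ∀ a b, adj a b → adj b a) (f : V → ZMod 2) (hf : f ≠ 0)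
    (hk : ∀ v, ∑ w, (if adj v w then f w else 0) = 0) :
    Even (Nat.card {σ : Equiv.Perm V // (∀ v, adj v (σ v)) ∧ σ⁻¹ = σ}) := by
  let A : Matrix V V (ZMod 2) := fun v w => if adj v w then 1 else 0
  have hdet : A.det = 0 := by
    rw [← Matrix.exists_mulVec_eq_zero_iff]
    refine ⟨f, hf, ?_⟩
    funext v
    have := hk v
    simpa [Matrix.mulVec, dotProduct, A] using this
  rw [Matrix.det_apply] at hdet
  have h1 : ∑ σ : Equiv.Perm V, (if ∀ v, adj v (σ v) then (1 : ZMod 2) else 0) = 0 := by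
    refine Eq.trans ?_ hdet
    refine Finset.sum_congr rfl fun σ _ => ?_
    have hsg : ∀ x : ZMod 2, Equiv.Perm.sign σ • x = x := by
      intro x
      rcases Int.units_eq_one_or (Equiv.Perm.sign σ) with h | h
      · simp [h]
      · rw [h]; simp [Units.smul_def, ZMod.neg_eq_self_mod_two]
    rw [hsg]
    simp only [A]
    rw [Finset.prod_ite_zero]
    simp only [Finset.mem_univ, true_implies, Finset.prod_const_one]
    refine if_congr ⟨fun h v => hs _ _ (h v), fun h v => hs _ _ (h v)⟩ rfl rfl
  rw [← Finset.sum_filter] at h1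
  rw [← Finset.sum_filter_add_sum_filter_not _ (fun σ : Equiv.Perm V => σ⁻¹ = σ)] at h1
  have h2 : ∑ σ ∈ (Finset.univ.filter (fun σ : Equiv.Perm V => ∀ v, adj v (σ v))).filter
      (fun σ => ¬ σ⁻¹ = σ), (1 : ZMod 2) = 0 := by
    refine Finset.sum_involution (fun σ _ => σ⁻¹) ?_ ?_ ?_ ?_
    · intros; decide
    · intro σ hσ _; simp at hσ; exact hσ.2
    · intro σ hσ
      simp only [Finset.mem_filter, Finset.mem_univ, true_and, inv_inv] at hσ ⊢
      refine ⟨fun v => ?_, fun h => hσ.2 h.symm⟩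
      have := hs _ _ (hσ.1 (σ⁻¹ v))
      simpa using this
    · intros; simp
  rw [h2, add_zero, Finset.sum_const, nsmul_eq_mul, mul_one, ZMod.natCast_eq_zero_iff_even,
    Finset.filter_filter] at h1
  rw [Nat.card_eq_fintype_card, Fintype.card_subtype]
  exact h1

theorem numTilings_eq (R : Set (ℤ × ℤ)) : numTilings R =
    Nat.card {σ : Equiv.Perm R // (∀ v : R, Adjacent v (σ v)) ∧ σ⁻¹ = σ} := by
  symm
  unfold numTilings
  have inv : ∀ (σ : Equiv.Perm R), σ⁻¹ = σ → ∀ v, σ (σ v) = v := by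
    intro σ h v
    conv_lhs => rw [← h]
    rw [h]
    nth_rewrite 1 [← h]
    simp
  refine Nat.card_congr (Equiv.ofBijective (fun σ => ⟨{d | ∃ v : R, d = {v.1, (σ.1 v).1}}, ?_, ?_, ?_⟩) ⟨?_, ?_⟩)
  · rintro d ⟨v, rfl⟩
    exact ⟨_, _, σ.2.1 v, rfl⟩
  · rintro _ ⟨v, rfl⟩ _ ⟨w, rfl⟩ hne
    have hv := inv _ σ.2.2 v
    have hw := inv _ σ.2.2 w
    rw [Function.onFun, Set.disjoint_left]
    intro x hx hx'
    apply hne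
    simp only [id, Set.mem_insert_iff, Set.mem_singleton_iff] at hx hx'
    rcases hx with rfl | rfl <;> rcases hx' with h | h
    · rw [Subtype.ext h]
    · have h := Subtype.ext h
      subst h
      rw [hw, Set.pair_comm]
    · have h := Subtype.ext h
      subst h
      rw [hv, Set.pair_comm]
    · have h := σ.1.injective (Subtype.ext h)
      rw [h]
  · ext x
    simp only [Set.mem_sUnion, Set.mem_ofPred_eq]
    constructor
    · rintro ⟨_, ⟨v, rfl⟩, rfl | h⟩
      · exact v.2
      · rw [Set.mem_singleton_iff] at h
        rw [h]; exact (σ.1 v).2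
    · intro hx
      exact ⟨_, ⟨⟨x, hx⟩, rfl⟩, by simp⟩
  · intro σ τ h
    have h := congrArg Subtype.val h
    simp only at h
    apply Subtype.ext
    ext1 v
    have h1 : ({v.1, (σ.1 v).1} : Set (ℤ × ℤ)) ∈ {d | ∃ v : R, d = {v.1, (σ.1 v).1}} := ⟨v, rfl⟩
    rw [h] at h1
    obtain ⟨w, hw⟩ := h1
    rw [Set.pair_eq_pair_iff] at hw
    rcases hw with ⟨h1, h2⟩ | ⟨h1, h2⟩
    · rw [Subtype.ext h2, Subtype.ext h1]
    · rw [Subtype.ext h2, Subtype.ext h1, inv _ τ.2.2]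
  · rintro ⟨T, hT1, hT2, hT3⟩
    have uniq : ∀ d ∈ T, ∀ e ∈ T, ∀ x, x ∈ d → x ∈ e → d = e := by
      intro d hd e he x hx hx'
      by_contra hne
      exact Set.disjoint_left.1 (hT2 hd he hne) hx hx'
    have ex : ∀ v : R, ∃ w : R, Adjacent v w ∧ ({v.1, w.1} : Set (ℤ × ℤ)) ∈ T := by
      rintro ⟨v, hv⟩
      have hv' := hv
      rw [← hT3] at hv'
      obtain ⟨d, hd, hvd⟩ := hv'
      obtain ⟨a, b, hab, rfl⟩ := hT1 d hd
      have ha : a ∈ R := hT3 ▸ ⟨_, hd, by simp⟩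
      have hb : b ∈ R := hT3 ▸ ⟨_, hd, by simp⟩
      rcases hvd with rfl | h
      · exact ⟨⟨b, hb⟩, hab, hd⟩
      · rw [Set.mem_singleton_iff] at h
        subst h
        exact ⟨⟨a, ha⟩, adjacent_symm' hab, by rwa [Set.pair_comm]⟩
    choose g hg1 hg2 using ex
    have hgg : ∀ v, g (g v) = v := by
      intro v
      have := uniq _ (hg2 v) _ (hg2 (g v)) (g v).1 (by simp) (by simp)
      rw [Set.pair_eq_pair_iff] at this
      rcases this with ⟨h1, h2⟩ | ⟨h1, h2⟩
      · exact absurd h1 (adjacent_ne' (hg1 v))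
      · exact (Subtype.ext h1).symm
    refine ⟨⟨⟨g, g, hgg, hgg⟩, hg1, ?_⟩, ?_⟩
    · ext1 v; rfl
    · apply Subtype.ext
      ext d
      simp only [Set.mem_ofPred_eq, Equiv.coe_fn_mk]
      constructor
      · rintro ⟨v, rfl⟩; exact hg2 v
      · intro hd
        obtain ⟨a, b, hab, rfl⟩ := hT1 d hd
        have ha : a ∈ R := hT3 ▸ ⟨_, hd, by simp⟩
        exact ⟨⟨a, ha⟩, uniq _ hd _ (hg2 ⟨a, ha⟩) a (by simp) (by simp)⟩

theorem Treg_finite (i j p : ℕ) : (Treg i j p).Finite := by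
  refine Set.Finite.subset (Set.finite_Icc ((-(i + j + p + p) : ℤ), (-(i + j + p + p) : ℤ))
    ((i + j + p + p : ℤ), (i + j + p + p : ℤ))) ?_
  rintro ⟨x, y⟩ h
  simp only [Treg, Set.mem_ofPred_eq] at h
  simp only [Set.mem_Icc, Prod.mk_le_mk]
  omega

theorem T_k_2k1_even (k p : ℕ) (hk : 0 < k) (hp : 0 < p) :
    Even (numTilings (Treg k (2 * k + 1) p)) := by
  classical
  rw [numTilings_eq]
  have : Fintype (Treg k (2 * k + 1) p) := (Treg_finite _ _ _).fintype
  let F : ℤ × ℤ → ZMod 2 := fun q =>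
    if q.1 - (p - 1 + k) = q.2 + 1 ∨ -(q.1 - (p - 1 + k)) = q.2 + 1 then 1 else 0
  refine even_involutions (fun a b : Treg k (2 * k + 1) p => Adjacent a b)
    (fun a b h => adjacent_symm' h) (fun v => F v) ?_ ?_
  · intro h
    have hm : ((p + k : ℤ), (0 : ℤ)) ∈ Treg k (2 * k + 1) p := by
      simp only [Treg, Set.mem_ofPred_eq]
      refine ⟨?_, ?_, ?_, ?_⟩ <;> omega
    have := congrFun h ⟨_, hm⟩
    simp only [F, Pi.zero_apply] at this
    rw [if_pos (by left; ring)] at this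
    exact one_ne_zero this
  · rintro ⟨⟨c, r⟩, hv⟩
    rw [Finset.sum_ite, Finset.sum_const_zero, add_zero]
    simp only [F]
    rw [← Finset.sum_filter, Finset.filter_filter, Finset.sum_const, nsmul_eq_mul, mul_one,
      ZMod.natCast_eq_zero_iff_even]
    simp only [Treg, Set.mem_ofPred_eq] at hv
    push_cast at hv
    have key : ∀ a1 a2 b1 b2 : ℤ, ((a1, a2) : ℤ × ℤ) ∈ Treg k (2 * k + 1) p →
        ((b1, b2) : ℤ × ℤ) ∈ Treg k (2 * k + 1) p → (a1 ≠ b1 ∨ a2 ≠ b2) →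
        (∀ x y : ℤ, ((x, y) : ℤ × ℤ) ∈ Treg k (2 * k + 1) p →
          ((Adjacent (c, r) (x, y) ∧
            (x - (p - 1 + k) = y + 1 ∨ -(x - (p - 1 + k)) = y + 1)) ↔
            ((x = a1 ∧ y = a2) ∨ (x = b1 ∧ y = b2)))) →
        Even (Finset.card (Finset.univ.filter (fun w : Treg k (2 * k + 1) p =>
          Adjacent (c, r) w ∧
            (w.1.1 - (p - 1 + k) = w.1.2 + 1 ∨ -(w.1.1 - (p - 1 + k)) = w.1.2 + 1)))) := by
      intro a1 a2 b1 b2 ha hb hne h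
      have : (Finset.univ.filter (fun w : Treg k (2 * k + 1) p =>
          Adjacent (c, r) w ∧
            (w.1.1 - (p - 1 + k) = w.1.2 + 1 ∨ -(w.1.1 - (p - 1 + k)) = w.1.2 + 1)))
          = {⟨(a1, a2), ha⟩, ⟨(b1, b2), hb⟩} := by
        ext ⟨⟨x, y⟩, hw⟩
        simp only [Finset.mem_filter, Finset.mem_univ, true_and, Finset.mem_insert,
          Finset.mem_singleton, Subtype.mk.injEq, Prod.mk.injEq]
        exact h x y hw
      rw [this, Finset.card_pair]
      · exact even_two
      · simp only [ne_eq, Subtype.mk.injEq, Prod.mk.injEq]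
        omega
    simp only [Treg, Set.mem_ofPred_eq, Adjacent] at key
    push_cast at key
    obtain ⟨x, hx⟩ : ∃ x : ℤ, c = x + (p - 1 + k) := ⟨c - (p - 1 + k), by ring⟩
    by_cases h0 : x = 0 ∧ r = 0
    · exact key (c + 1) r (c - 1) r (by omega) (by omega) (by omega) (by intros; omega)
    by_cases h1 : x = r
    · exact key (c + 1) r c (r - 1) (by omega) (by omega) (by omega) (by intros; omega)
    by_cases h2 : x = -r
    · exact key (c - 1) r c (r - 1) (by omega) (by omega) (by omega) (by intros; omega)
    by_cases h3 : x = r + 2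
    · exact key (c - 1) r c (r + 1) (by omega) (by omega) (by omega) (by intros; omega)
    by_cases h4 : x = -(r + 2)
    · exact key (c + 1) r c (r + 1) (by omega) (by omega) (by omega) (by intros; omega)
    rw [Finset.filter_false_of_mem]
    · simp
    · rintro ⟨⟨a, b⟩, hw⟩ -
      simp only [Treg, Set.mem_ofPred_eq] at hw
      simp only [Adjacent]
      push_cast at hw
      omega
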